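/- arXiv:1411.1915 — 4 statements merged into one kernel-verified Lean document; each statement's English description precedes it below -/
import Mathlib

section
/- Let k ≥ 1 be an integer, R > 0, and let x ∈ ℝ^{k+1} be a fixed point with |x| ≠ R. If α, β ∈ ℂ satisfy α + β = 2k, then ∫_{S^k(R)} |x − y|^{−α} dS_y = |R² − |x|²|^{(β−α)/2} · ∫_{S^k(R)} |x − y|^{−β} dS_y, where for a positive real t and complex exponent γ the power t^γ is defined as exp(γ · ln t). -/
open MeasureTheory
open scoped NNReal ENNReal Topology

section HausdorffChangeOfVariables

variable {X : Type*} [EMetricSpace X] [MeasurableSpace X] [BorelSpace X]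

/-- A map contracting distances by the factor `ρ y * ρ z` increases Hausdorff measure at most
by the density `(ρ * ρ) ^ d`. -/
theorem hausdorffMeasure_image_le_setLIntegral {s : Set X} (hs : MeasurableSet s) {σ : X → X}
    {ρ : X → ℝ≥0} (hρ : Measurable ρ) (hρ0 : ∀ y ∈ s, ρ y ≠ 0)
    (hσ : ∀ y ∈ s, ∀ z ∈ s, edist (σ y) (σ z) ≤ (ρ y * ρ z : ℝ≥0) * edist y z)
    {d : ℝ} (hd : 0 ≤ d) :
    μH[d] (σ '' s) ≤ ∫⁻ y in s, (((ρ y * ρ y) ^ d : ℝ≥0) : ℝ≥0∞) ∂μH[d] := by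
  set I := ∫⁻ y in s, (((ρ y * ρ y) ^ d : ℝ≥0) : ℝ≥0∞) ∂μH[d]
  have key : ∀ t : ℝ≥0, 1 < t → μH[d] (σ '' s) ≤ (((t * t) ^ d : ℝ≥0) : ℝ≥0∞) * I := by
    intro t ht
    set A : ℤ → Set X := fun n => s ∩ ρ ⁻¹' Set.Ico (t ^ n) (t ^ (n + 1)) with hA
    have hAm : ∀ n, MeasurableSet (A n) := fun n => hs.inter (hρ measurableSet_Ico)
    have hAs : ⋃ n, A n = s := by
      ext y
      simp only [hA, Set.mem_iUnion, Set.mem_inter_iff, Set.mem_preimage]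
      refine ⟨fun ⟨_, h, _⟩ => h, fun h => ?_⟩
      obtain ⟨n, hn⟩ := NNReal.exists_mem_Ico_zpow (hρ0 y h) ht
      exact ⟨n, h, hn⟩
    have hAd : Pairwise (Function.onFun Disjoint A) := by
      intro m n hmn
      refine Set.disjoint_left.2 fun y hm hn => hmn ?_
      have h1 := (zpow_lt_zpow_iff_right₀ ht).1 (hm.2.1.trans_lt hn.2.2)
      have h2 := (zpow_lt_zpow_iff_right₀ ht).1 (hn.2.1.trans_lt hm.2.2)
      omega
    have hpiece : ∀ n, μH[d] (σ '' A n) ≤ (((t * t) ^ d : ℝ≥0) : ℝ≥0∞) *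
        ∫⁻ y in A n, (((ρ y * ρ y) ^ d : ℝ≥0) : ℝ≥0∞) ∂μH[d] := by
      intro n
      have hlip : LipschitzOnWith (t ^ (n + 1) * t ^ (n + 1)) σ (A n) := by
        intro y hy z hz
        refine (hσ y hy.1 z hz.1).trans ?_
        gcongr
        exacts [hy.2.2.le, hz.2.2.le]
      refine (hlip.hausdorffMeasure_image_le hd).trans ?_
      rw [← ENNReal.coe_rpow_of_nonneg _ hd, ← setLIntegral_const,
        ← lintegral_const_mul' _ _ ENNReal.coe_ne_top]
      refine setLIntegral_mono' (hAm n) fun y hy => ?_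
      rw [← ENNReal.coe_mul, ← NNReal.mul_rpow]
      refine ENNReal.coe_le_coe.2 (NNReal.rpow_le_rpow ?_ hd)
      rw [zpow_add_one₀ (zero_lt_one.trans ht).ne', mul_mul_mul_comm, mul_comm]
      gcongr
      exacts [hy.2.1, hy.2.1]
    calc μH[d] (σ '' s) = μH[d] (⋃ n, σ '' A n) := by rw [← Set.image_iUnion, hAs]
      _ ≤ ∑' n, μH[d] (σ '' A n) := measure_iUnion_le _
      _ ≤ ∑' n, (((t * t) ^ d : ℝ≥0) : ℝ≥0∞) *
          ∫⁻ y in A n, (((ρ y * ρ y) ^ d : ℝ≥0) : ℝ≥0∞) ∂μH[d] := ENNReal.tsum_le_tsum hpiece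
      _ = _ := by rw [ENNReal.tsum_mul_left, ← lintegral_iUnion hAm hAd, hAs]
  have hlim : Filter.Tendsto (fun t : ℝ≥0 => (((t * t) ^ d : ℝ≥0) : ℝ≥0∞) * I) (𝓝[>] 1)
      (𝓝 (1 * I)) := by
    refine ENNReal.Tendsto.mul_const ?_ (Or.inl one_ne_zero)
    rw [← ENNReal.coe_one, ENNReal.tendsto_coe]
    have hc : Continuous fun t : ℝ≥0 => (t * t) ^ d :=
      (NNReal.continuous_rpow_const hd).comp (continuous_id.mul continuous_id)
    simpa using (hc.tendsto 1).mono_left nhdsWithin_le_nhds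
  rw [one_mul] at hlim
  exact ge_of_tendsto hlim (eventually_mem_nhdsWithin.mono key)

/-- Change of variables for Hausdorff measure under an involution of `s` that is conformal in the
strong sense `edist (σ y) (σ z) = ρ y * ρ z * edist y z`. -/
theorem map_hausdorffMeasure_restrict_of_involution {s : Set X} (hs : MeasurableSet s) {σ : X → X}
    (hσm : Measurable σ) (hσs : Set.MapsTo σ s s) (hσσ : ∀ y ∈ s, σ (σ y) = y)
    {ρ : X → ℝ≥0} (hρ : Measurable ρ) (hρσ : ∀ y ∈ s, ρ (σ y) * ρ y = 1)
    (hσ : ∀ y ∈ s, ∀ z ∈ s, edist (σ y) (σ z) ≤ (ρ y * ρ z : ℝ≥0) * edist y z)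
    {d : ℝ} (hd : 0 ≤ d) :
    (μH[d].restrict s).map σ = (μH[d].restrict s).withDensity
      fun y => (((ρ y * ρ y) ^ d : ℝ≥0) : ℝ≥0∞) := by
  have hρ0 : ∀ y ∈ s, ρ y ≠ 0 := fun y hy => right_ne_zero_of_mul_eq_one (hρσ y hy)
  have hDm : Measurable fun y => (((ρ y * ρ y) ^ d : ℝ≥0) : ℝ≥0∞) := by fun_prop
  have hle : (μH[d].restrict s).map σ ≤ (μH[d].restrict s).withDensity
      fun y => (((ρ y * ρ y) ^ d : ℝ≥0) : ℝ≥0∞) := by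
    refine Measure.le_iff.2 fun A hA => ?_
    have himage : σ ⁻¹' A ∩ s = σ '' (A ∩ s) := by
      ext y
      constructor
      · rintro ⟨hyA, hys⟩
        exact ⟨σ y, ⟨hyA, hσs hys⟩, hσσ y hys⟩
      · rintro ⟨z, ⟨hzA, hzs⟩, rfl⟩
        exact ⟨by simpa [hσσ z hzs] using hzA, hσs hzs⟩
    rw [Measure.map_apply hσm hA, Measure.restrict_apply (hσm hA), himage,
      withDensity_apply _ hA, Measure.restrict_restrict hA]
    exact hausdorffMeasure_image_le_setLIntegral (hA.inter hs) hρ (fun y hy => hρ0 y hy.2)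
      (fun y hy z hz => hσ y hy.2 z hz.2) hd
  refine le_antisymm hle (Measure.le_iff.2 fun A hA => ?_)
  have hDσ : ∀ y ∈ s, (((ρ y * ρ y) ^ d : ℝ≥0) : ℝ≥0∞) *
      (((ρ (σ y) * ρ (σ y)) ^ d : ℝ≥0) : ℝ≥0∞) = 1 := by
    intro y hy
    rw [← ENNReal.coe_mul, ← NNReal.mul_rpow, mul_mul_mul_comm, mul_comm (ρ y), hρσ y hy]
    simp
  set D : X → ℝ≥0∞ := fun y => (((ρ y * ρ y) ^ d : ℝ≥0) : ℝ≥0∞)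
  have hm1 : Measurable (A.indicator (1 : X → ℝ≥0∞)) := measurable_one.indicator hA
  have hgm : Measurable fun y => A.indicator (1 : X → ℝ≥0∞) (σ y) * D (σ y) :=
    (hm1.comp hσm).mul (hDm.comp hσm)
  calc (μH[d].restrict s).withDensity D A
      = ∫⁻ y in s, A.indicator (1 : X → ℝ≥0∞) y * D y ∂μH[d] := by
        rw [withDensity_apply _ hA, ← lintegral_indicator hA]
        refine lintegral_congr fun y => ?_
        by_cases hy : y ∈ A <;> simp [hy]
    _ = ∫⁻ y in s, A.indicator (1 : X → ℝ≥0∞) (σ (σ y)) * D (σ (σ y)) ∂μH[d] :=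
        setLIntegral_congr_fun hs fun y hy => by simp only [hσσ y hy]
    _ = ∫⁻ y, A.indicator (1 : X → ℝ≥0∞) (σ y) * D (σ y) ∂(μH[d].restrict s).map σ :=
        (lintegral_map hgm hσm).symm
    _ ≤ ∫⁻ y, A.indicator (1 : X → ℝ≥0∞) (σ y) * D (σ y) ∂(μH[d].restrict s).withDensity D :=
        lintegral_mono' hle le_rfl
    _ = ∫⁻ y in s, D y * (A.indicator (1 : X → ℝ≥0∞) (σ y) * D (σ y)) ∂μH[d] :=
        lintegral_withDensity_eq_lintegral_mul _ hDm hgm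
    _ = ∫⁻ y in s, A.indicator (1 : X → ℝ≥0∞) (σ y) ∂μH[d] :=
        setLIntegral_congr_fun hs fun y hy => by
          rw [mul_left_comm, hDσ y hy, mul_one]
    _ = (μH[d].restrict s).map σ A := by
        rw [← lintegral_map hm1 hσm, lintegral_indicator_one hA]

end HausdorffChangeOfVariables

section SphereInvolution

variable {E : Type*} [NormedAddCommGroup E] [InnerProductSpace ℝ E]

/-- The map sending a point `y` of the sphere of radius `R` to the second intersection point of
that sphere with the line through `x` and `y`. -/
noncomputable def sphereInvolution (R : ℝ) (x y : E) : E :=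
  x + (‖x‖ ^ 2 - R ^ 2) • ((1 / ‖y - x‖) ^ 2 • (y - x))

theorem norm_sphereInvolution_sub (R : ℝ) {x y : E} (hy : y ≠ x) :
    ‖sphereInvolution R x y - x‖ = |‖x‖ ^ 2 - R ^ 2| / ‖y - x‖ := by
  have h : ‖y - x‖ ≠ 0 := norm_ne_zero_iff.2 (sub_ne_zero.2 hy)
  rw [sphereInvolution, add_sub_cancel_left, norm_smul, norm_smul, Real.norm_eq_abs,
    Real.norm_of_nonneg (by positivity)]
  field_simp

theorem sphereInvolution_sphereInvolution {R : ℝ} {x y : E} (hx : ‖x‖ ^ 2 - R ^ 2 ≠ 0)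
    (hy : y ≠ x) : sphereInvolution R x (sphereInvolution R x y) = y := by
  have h : ‖y - x‖ ≠ 0 := norm_ne_zero_iff.2 (sub_ne_zero.2 hy)
  rw [sphereInvolution, norm_sphereInvolution_sub R hy, sphereInvolution, add_sub_cancel_left,
    smul_smul, smul_smul, smul_smul, div_pow, div_pow, sq_abs]
  have : (‖x‖ ^ 2 - R ^ 2) * (1 ^ 2 / ((‖x‖ ^ 2 - R ^ 2) ^ 2 / ‖y - x‖ ^ 2) * (‖x‖ ^ 2 - R ^ 2)
      * (1 / ‖y - x‖) ^ 2) = 1 := by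
    field_simp
  simp only [← mul_assoc] at this ⊢
  rw [this, one_smul, add_sub_cancel]

theorem dist_sphereInvolution_sphereInvolution (R : ℝ) {x y z : E} (hy : y ≠ x) (hz : z ≠ x) :
    dist (sphereInvolution R x y) (sphereInvolution R x z) =
      |‖x‖ ^ 2 - R ^ 2| / (‖y - x‖ * ‖z - x‖) * dist y z := by
  rw [sphereInvolution, sphereInvolution, dist_add_left, dist_smul₀,
    dist_div_norm_sq_smul (sub_ne_zero.2 hy) (sub_ne_zero.2 hz), dist_sub_right,
    Real.norm_eq_abs]
  ring

theorem norm_sphereInvolution {R : ℝ} {x y : E} (hR : 0 ≤ R) (hyR : ‖y‖ = R) (hy : y ≠ x) :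
    ‖sphereInvolution R x y‖ = R := by
  have h : ‖y - x‖ ≠ 0 := norm_ne_zero_iff.2 (sub_ne_zero.2 hy)
  have h2 : ‖y - x‖ ^ 2 = ‖y‖ ^ 2 - 2 * inner ℝ y x + ‖x‖ ^ 2 := norm_sub_sq_real y x
  have h3 : inner ℝ x (y - x) = inner ℝ y x - ‖x‖ ^ 2 := by
    rw [inner_sub_right, real_inner_self_eq_norm_sq, real_inner_comm]
  refine (sq_eq_sq₀ (norm_nonneg _) hR).1 ?_
  rw [sphereInvolution, smul_smul, norm_add_sq_real, norm_smul, inner_smul_right, h3, mul_pow,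
    Real.norm_eq_abs, sq_abs]
  have h4 : inner ℝ y x = (R ^ 2 + ‖x‖ ^ 2 - ‖y - x‖ ^ 2) / 2 := by rw [h2, hyR]; ring
  rw [h4]
  field_simp
  ring

end SphereInvolution

theorem stmt_7 (k : ℕ) (hk : 1 ≤ k) (R : ℝ) (hR : 0 < R)
    (x : EuclideanSpace ℝ (Fin (k + 1))) (hx : ‖x‖ ≠ R)
    (α β : ℂ) (hαβ : α + β = 2 * (k : ℂ)) :
    ∫ y in Metric.sphere (0 : EuclideanSpace ℝ (Fin (k + 1))) R,
        Complex.exp (-α * (Real.log ‖x - y‖ : ℂ)) ∂(μH[(k : ℝ)]) =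
    Complex.exp ((β - α) / 2 * (Real.log |R ^ 2 - ‖x‖ ^ 2| : ℂ)) *
      ∫ y in Metric.sphere (0 : EuclideanSpace ℝ (Fin (k + 1))) R,
        Complex.exp (-β * (Real.log ‖x - y‖ : ℂ)) ∂(μH[(k : ℝ)]) := by
  set s := Metric.sphere (0 : EuclideanSpace ℝ (Fin (k + 1))) R
  have hs : MeasurableSet s := Metric.isClosed_sphere.measurableSet
  have hsR : ∀ y ∈ s, ‖y‖ = R := fun y hy => mem_sphere_zero_iff_norm.1 hy
  have hne : ∀ y ∈ s, y ≠ x := by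
    rintro y hy rfl
    exact hx (hsR y hy)
  have hpos : ∀ y ∈ s, 0 < ‖y - x‖ := fun y hy => norm_pos_iff.2 (sub_ne_zero.2 (hne y hy))
  have hp : ‖x‖ ^ 2 - R ^ 2 ≠ 0 :=
    sub_ne_zero.2 fun h => hx ((sq_eq_sq₀ (norm_nonneg x) hR.le).1 h)
  set p := ‖x‖ ^ 2 - R ^ 2
  have hp' : 0 < |p| := abs_pos.2 hp
  set σ := sphereInvolution R x
  set ρ : EuclideanSpace ℝ (Fin (k + 1)) → ℝ≥0 := fun y => (√|p| / ‖y - x‖).toNNReal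
  have hρc : ∀ y, (ρ y : ℝ) = √|p| / ‖y - x‖ := fun y => Real.coe_toNNReal _ (by positivity)
  have hρm : Measurable ρ := by fun_prop
  have hσm : Measurable σ := by
    unfold σ sphereInvolution
    fun_prop
  have hnorm : ∀ y ∈ s, ‖σ y - x‖ = |p| / ‖y - x‖ :=
    fun y hy => norm_sphereInvolution_sub R (hne y hy)
  have hsq : √|p| * √|p| = |p| := Real.mul_self_sqrt hp'.le
  have hmap := map_hausdorffMeasure_restrict_of_involution hs hσm
    (fun y hy => mem_sphere_zero_iff_norm.2 (norm_sphereInvolution hR.le (hsR y hy) (hne y hy)))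
    (fun y hy => sphereInvolution_sphereInvolution hp (hne y hy)) hρm
    (fun y hy => by
      rw [← NNReal.coe_inj, NNReal.coe_mul, hρc, hρc, hnorm y hy, NNReal.coe_one]
      have := hpos y hy
      field_simp
      rw [Real.sq_sqrt hp'.le])
    (fun y hy z hz => by
      rw [edist_nndist, edist_nndist, ← ENNReal.coe_mul, ENNReal.coe_le_coe, ← NNReal.coe_le_coe,
        NNReal.coe_mul, NNReal.coe_mul, coe_nndist, coe_nndist, hρc, hρc,
        dist_sphereInvolution_sphereInvolution R (hne y hy) (hne z hz), div_mul_div_comm, hsq])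
    (Nat.cast_nonneg k)
  have hfm : Measurable fun y : EuclideanSpace ℝ (Fin (k + 1)) =>
      Complex.exp (β * (Real.log ‖x - y‖ : ℂ)) := by fun_prop
  have hDm : Measurable fun y => (ρ y * ρ y) ^ (k : ℝ) := by fun_prop
  have hint : ∫ y in s, Complex.exp (β * (Real.log ‖x - σ y‖ : ℂ)) ∂(μH[(k : ℝ)]) =
      ∫ y in s, (ρ y * ρ y) ^ (k : ℝ) • Complex.exp (β * (Real.log ‖x - y‖ : ℂ))
        ∂(μH[(k : ℝ)]) := by
    rw [← integral_map hσm.aemeasurable hfm.aestronglyMeasurable, hmap,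
      integral_withDensity_eq_integral_smul hDm]
  have hleft : ∫ y in s, Complex.exp (β * (Real.log ‖x - σ y‖ : ℂ)) ∂(μH[(k : ℝ)]) =
      Complex.exp (β * (Real.log |p| : ℂ)) *
        ∫ y in s, Complex.exp (-β * (Real.log ‖x - y‖ : ℂ)) ∂(μH[(k : ℝ)]) := by
    rw [← integral_const_mul]
    refine setIntegral_congr_fun hs fun y hy => ?_
    rw [norm_sub_rev, hnorm y hy, norm_sub_rev x y, Real.log_div hp'.ne' (hpos y hy).ne',
      ← Complex.exp_add]
    push_cast
    ring_nf
  have hright : ∫ y in s, (ρ y * ρ y) ^ (k : ℝ) • Complex.exp (β * (Real.log ‖x - y‖ : ℂ))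
        ∂(μH[(k : ℝ)]) = Complex.exp (k * (Real.log |p| : ℂ)) *
        ∫ y in s, Complex.exp (-α * (Real.log ‖x - y‖ : ℂ)) ∂(μH[(k : ℝ)]) := by
    rw [← integral_const_mul]
    refine setIntegral_congr_fun hs fun y hy => ?_
    have hlog : (((ρ y * ρ y) ^ (k : ℝ) : ℝ≥0) : ℝ) =
        Real.exp (k * (Real.log |p| - 2 * Real.log ‖x - y‖)) := by
      have hy0 := hpos y hy
      rw [NNReal.coe_rpow, NNReal.coe_mul, hρc, div_mul_div_comm, hsq,
        Real.rpow_def_of_pos (by positivity), Real.log_div hp'.ne' (by positivity),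
        Real.log_mul hy0.ne' hy0.ne', norm_sub_rev x y]
      ring_nf
    rw [NNReal.smul_def, hlog, Complex.real_smul, Complex.ofReal_exp, ← Complex.exp_add,
      ← Complex.exp_add, eq_sub_of_add_eq hαβ]
    push_cast
    ring_nf
  rw [hleft, hright] at hint
  have hexp : (β - α) / 2 * (Real.log |p| : ℂ) =
      β * (Real.log |p| : ℂ) - k * (Real.log |p| : ℂ) := by
    rw [eq_sub_of_add_eq hαβ]
    ring
  rw [abs_sub_comm, hexp, Complex.exp_sub, div_mul_eq_mul_div, hint,
    mul_div_cancel_left₀ _ (Complex.exp_ne_zero _)]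
end

section
/- Let k ≥ 1 be an integer, R > 0, and let x ∈ ℝ^{k+1} be a fixed point with |x| ≠ R. Then ∫_{S^k(R)} |x − y|^{−(k−1)} dS_y = ∫_{S^k(R)} |R² − |x|²| · |x − y|^{−(k+1)} dS_y; that is, the surface integral over S^k(R) of the Newtonian potential kernel of pole x equals the surface integral of the Poisson kernel of x for the ball of radius R. -/
open MeasureTheory

open scoped NNReal ENNReal

/-- If `edist (T y) (T z) ≤ ρ y * ρ z * edist y z` on `A`, then `T` increases the `d`-dimensional
Hausdorff measure infinitesimally by at most the factor `ρ ^ (2 * d)` on `A`. -/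
theorem hausdorffMeasure_image_le_lintegral {X Y : Type*} [EMetricSpace X] [MeasurableSpace X]
    [BorelSpace X] [EMetricSpace Y] [MeasurableSpace Y] [BorelSpace Y]
    {T : X → Y} {ρ : X → ℝ≥0} (hρ : Measurable ρ) {A : Set X} (hA : MeasurableSet A)
    (hpos : ∀ y ∈ A, 0 < ρ y)
    (hT : ∀ y ∈ A, ∀ z ∈ A, edist (T y) (T z) ≤ ρ y * ρ z * edist y z)
    {d : ℝ} (hd : 0 ≤ d) :
    μH[d] (T '' A) ≤ ∫⁻ y in A, (ρ y : ℝ≥0∞) ^ (2 * d) ∂μH[d] := by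
  have key : ∀ l : ℝ≥0, 1 < l → μH[d] (T '' A) ≤
      (l : ℝ≥0∞) ^ (2 * d) * ∫⁻ y in A, (ρ y : ℝ≥0∞) ^ (2 * d) ∂μH[d] := by
    intro l hl
    have hl0 : l ≠ 0 := (zero_lt_one.trans hl).ne'
    let B : ℤ → Set X := fun n => A ∩ ρ ⁻¹' Set.Ico (l ^ n) (l ^ (n + 1))
    have hB : ∀ n, MeasurableSet (B n) := fun n => hA.inter (hρ measurableSet_Ico)
    have hAB : A = ⋃ n, B n := by
      ext y
      simp only [B, Set.mem_iUnion, Set.mem_inter_iff, exists_and_left]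
      refine ⟨fun hy => ⟨hy, ?_⟩, fun h => h.1⟩
      exact exists_mem_Ico_zpow (hpos y hy) hl
    have hdisj : Pairwise (Function.onFun Disjoint B) := by
      intro m n hmn
      have h := (zpow_right_mono₀ hl.le).pairwise_disjoint_on_Ico_succ hmn
      exact (h.preimage ρ).mono Set.inter_subset_right Set.inter_subset_right
    have hpiece : ∀ n, μH[d] (T '' B n) ≤
        (l : ℝ≥0∞) ^ (2 * d) * ∫⁻ y in B n, (ρ y : ℝ≥0∞) ^ (2 * d) ∂μH[d] := by
      intro n
      have hlip : LipschitzOnWith (l ^ (n + 1) * l ^ (n + 1)) T (B n) := by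
        intro y hy z hz
        refine (hT y hy.1 z hz.1).trans ?_
        rw [ENNReal.coe_mul]
        gcongr
        · exact hy.2.2.le
        · exact hz.2.2.le
      refine (hlip.hausdorffMeasure_image_le hd).trans ?_
      have hc : ((l ^ (n + 1) * l ^ (n + 1) : ℝ≥0) : ℝ≥0∞) ^ d =
          (l : ℝ≥0∞) ^ (2 * d) * ((l ^ n : ℝ≥0) : ℝ≥0∞) ^ (2 * d) := by
        rw [← ENNReal.mul_rpow_of_nonneg _ _ (by positivity), ENNReal.rpow_mul,
          ← ENNReal.coe_mul, zpow_add_one₀ hl0]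
        congr 1
        rw [ENNReal.rpow_two, ← ENNReal.coe_pow]
        congr 1
        ring
      rw [hc, mul_assoc]
      gcongr
      rw [← setLIntegral_const]
      refine setLIntegral_mono' (hB n) fun y hy => ?_
      gcongr
      exact hy.2.1
    calc μH[d] (T '' A) = μH[d] (⋃ n, T '' B n) := by rw [← Set.image_iUnion, ← hAB]
      _ ≤ ∑' n, μH[d] (T '' B n) := measure_iUnion_le _
      _ ≤ ∑' n, (l : ℝ≥0∞) ^ (2 * d) * ∫⁻ y in B n, (ρ y : ℝ≥0∞) ^ (2 * d) ∂μH[d] :=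
        ENNReal.tsum_le_tsum hpiece
      _ = (l : ℝ≥0∞) ^ (2 * d) * ∫⁻ y in A, (ρ y : ℝ≥0∞) ^ (2 * d) ∂μH[d] := by
        rw [ENNReal.tsum_mul_left, ← lintegral_iUnion hB hdisj, ← hAB]
  set I := ∫⁻ y in A, (ρ y : ℝ≥0∞) ^ (2 * d) ∂μH[d]
  have hlim : Filter.Tendsto (fun l : ℝ≥0 => (l : ℝ≥0∞) ^ (2 * d) * I)
      (nhdsWithin 1 (Set.Ioi 1)) (nhds I) := by
    have h1 : Filter.Tendsto (fun l : ℝ≥0 => (l : ℝ≥0∞) ^ (2 * d)) (nhds 1) (nhds 1) := by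
      have := (ENNReal.continuous_rpow_const (y := 2 * d)).comp ENNReal.continuous_coe
      simpa [Function.comp_def] using this.tendsto 1
    simpa using ENNReal.Tendsto.mul_const (b := I) (h1.mono_left nhdsWithin_le_nhds)
      (Or.inl one_ne_zero)
  exact ge_of_tendsto hlim (Filter.eventually_of_mem self_mem_nhdsWithin key)

/-- One-sided change of variables for the Hausdorff measure under an involution `T` of `S` with
`edist (T y) (T z) ≤ ρ y * ρ z * edist y z`. -/
theorem setLIntegral_comp_hausdorffMeasure_le {X : Type*} [EMetricSpace X] [MeasurableSpace X]
    [BorelSpace X] {T : X → X} (hTm : Measurable T) (hTT : Function.Involutive T)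
    {ρ : X → ℝ≥0} (hρ : Measurable ρ) {S : Set X} (hS : MeasurableSet S)
    (hTS : Set.MapsTo T S S) (hpos : ∀ y ∈ S, 0 < ρ y)
    (hT : ∀ y ∈ S, ∀ z ∈ S, edist (T y) (T z) ≤ ρ y * ρ z * edist y z)
    {d : ℝ} (hd : 0 ≤ d) {f : X → ℝ≥0∞} (hf : Measurable f) :
    ∫⁻ y in S, f (T y) ∂μH[d] ≤ ∫⁻ y in S, (ρ y : ℝ≥0∞) ^ (2 * d) * f y ∂μH[d] := by
  have hle : (μH[d].restrict S).map T ≤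
      (μH[d].restrict S).withDensity fun y => (ρ y : ℝ≥0∞) ^ (2 * d) := by
    refine Measure.le_iff.2 fun B hB => ?_
    rw [Measure.map_apply hTm hB, Measure.restrict_apply (hTm hB), withDensity_apply _ hB,
      Measure.restrict_restrict hB]
    have himage : T ⁻¹' B ∩ S ⊆ T '' (B ∩ S) := fun y hy => ⟨T y, ⟨hy.1, hTS hy.2⟩, hTT y⟩
    exact (measure_mono himage).trans <| hausdorffMeasure_image_le_lintegral hρ (hB.inter hS)
      (fun y hy => hpos y hy.2) (fun y hy z hz => hT y hy.2 z hz.2) hd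
  calc ∫⁻ y in S, f (T y) ∂μH[d] = ∫⁻ y, f y ∂((μH[d].restrict S).map T) :=
        (lintegral_map hf hTm).symm
    _ ≤ ∫⁻ y, f y ∂((μH[d].restrict S).withDensity fun y => (ρ y : ℝ≥0∞) ^ (2 * d)) :=
        lintegral_mono' hle le_rfl
    _ = ∫⁻ y in S, (ρ y : ℝ≥0∞) ^ (2 * d) * f y ∂μH[d] :=
        lintegral_withDensity_eq_lintegral_mul _ (hρ.coe_nnreal_ennreal.pow_const _) hf

section SignedInversion

variable {E : Type*} [NormedAddCommGroup E] [InnerProductSpace ℝ E]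

/-- The inversion with centre `x` and power `s`, where `s` may be negative. -/
noncomputable def signedInversion (x : E) (s : ℝ) (y : E) : E :=
  x + (s / ‖x - y‖ ^ 2) • (y - x)

theorem norm_sub_signedInversion (x : E) (s : ℝ) (y : E) :
    ‖x - signedInversion x s y‖ = |s| / ‖x - y‖ := by
  have h : x - signedInversion x s y = -((s / ‖x - y‖ ^ 2) • (y - x)) := by
    simp [signedInversion]
  rw [h, norm_neg, norm_smul, norm_sub_rev y x, Real.norm_eq_abs, abs_div, abs_pow, abs_norm]
  rcases eq_or_ne ‖x - y‖ 0 with h0 | h0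
  · simp [h0]
  · field_simp

theorem signedInversion_involutive (x : E) {s : ℝ} (hs : s ≠ 0) :
    Function.Involutive (signedInversion x s) := by
  intro y
  rcases eq_or_ne y x with rfl | hy
  · simp [signedInversion]
  have h0 : ‖x - y‖ ≠ 0 := norm_ne_zero_iff.2 (sub_ne_zero.2 hy.symm)
  rw [signedInversion, norm_sub_signedInversion]
  simp only [signedInversion, add_sub_cancel_left, smul_smul]
  have : s / (|s| / ‖x - y‖) ^ 2 * (s / ‖x - y‖ ^ 2) = 1 := by
    rw [div_pow, sq_abs]
    field_simp
  rw [this, one_smul, add_sub_cancel]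

theorem dist_signedInversion {x y z : E} (s : ℝ) (hy : y ≠ x) (hz : z ≠ x) :
    dist (signedInversion x s y) (signedInversion x s z) =
      |s| / (‖x - y‖ * ‖x - z‖) * dist y z := by
  have h := dist_div_norm_sq_smul (sub_ne_zero.2 hy) (sub_ne_zero.2 hz) 1
  rw [dist_sub_right, one_pow] at h
  have hform : ∀ w, signedInversion x s w = x + s • (1 / ‖w - x‖) ^ 2 • (w - x) := by
    intro w
    rw [signedInversion, smul_smul, norm_sub_rev w x, div_pow, one_pow, mul_one_div]
  rw [hform y, hform z, dist_add_left, dist_smul₀, h, Real.norm_eq_abs, norm_sub_rev x y,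
    norm_sub_rev x z]
  ring

/-- Inversion with power the power of the point `x` preserves the sphere. -/
theorem norm_signedInversion_eq {x y : E} {R : ℝ} (hy : ‖y‖ = R) (hyx : y ≠ x) :
    ‖signedInversion x (‖x‖ ^ 2 - R ^ 2) y‖ = R := by
  have h0 : ‖x - y‖ ≠ 0 := norm_ne_zero_iff.2 (sub_ne_zero.2 hyx.symm)
  have hR : 0 ≤ R := hy ▸ norm_nonneg y
  rw [← sq_eq_sq₀ (norm_nonneg _) hR, signedInversion, norm_add_sq_real, norm_smul, mul_pow,
    real_inner_smul_right, norm_sub_rev y x, inner_sub_right, real_inner_self_eq_norm_sq,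
    Real.norm_eq_abs, sq_abs]
  have h := norm_sub_sq_real x y
  rw [hy] at h
  have h2 : inner ℝ x y = (‖x‖ ^ 2 + R ^ 2 - ‖x - y‖ ^ 2) / 2 := by linarith
  rw [h2]
  field_simp
  ring

theorem measurable_signedInversion [MeasurableSpace E] [BorelSpace E]
    [SecondCountableTopology E] (x : E) (s : ℝ) : Measurable (signedInversion x s) := by
  unfold signedInversion
  fun_prop

end SignedInversion

theorem stmt_8 (k : ℕ) (hk : 1 ≤ k) (R : ℝ) (hR : 0 < R)
    (x : EuclideanSpace ℝ (Fin (k + 1))) (hx : ‖x‖ ≠ R) :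
    ∫ y in Metric.sphere (0 : EuclideanSpace ℝ (Fin (k + 1))) R,
        ‖x - y‖ ^ (-((k : ℝ) - 1)) ∂(μH[(k : ℝ)]) =
    ∫ y in Metric.sphere (0 : EuclideanSpace ℝ (Fin (k + 1))) R,
        |R ^ 2 - ‖x‖ ^ 2| * ‖x - y‖ ^ (-((k : ℝ) + 1)) ∂(μH[(k : ℝ)]) := by
  set S := Metric.sphere (0 : EuclideanSpace ℝ (Fin (k + 1))) R
  set s : ℝ := ‖x‖ ^ 2 - R ^ 2 with hs_def
  rw [abs_sub_comm, ← hs_def]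
  have hs : s ≠ 0 := fun h => hx <|
    (sq_eq_sq₀ (norm_nonneg x) hR.le).1 (sub_eq_zero.1 h)
  have hs' : 0 < |s| := abs_pos.2 hs
  have hne : ∀ y ∈ S, y ≠ x := by
    rintro y hy rfl
    exact hx (mem_sphere_zero_iff_norm.1 hy)
  have hnorm : ∀ y ∈ S, 0 < ‖x - y‖ := fun y hy =>
    norm_pos_iff.2 (sub_ne_zero.2 (hne y hy).symm)
  let T := signedInversion x s
  let ρ : EuclideanSpace ℝ (Fin (k + 1)) → ℝ≥0 := fun y => Real.toNNReal (√|s| / ‖x - y‖)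
  have hTm : Measurable T := measurable_signedInversion x s
  have hTT : Function.Involutive T := signedInversion_involutive x hs
  have hρ : Measurable ρ := by fun_prop
  have hS : MeasurableSet S := Metric.isClosed_sphere.measurableSet
  have hTS : Set.MapsTo T S S := fun y hy => mem_sphere_zero_iff_norm.2 <|
    norm_signedInversion_eq (mem_sphere_zero_iff_norm.1 hy) (hne y hy)
  have hpos : ∀ y ∈ S, 0 < ρ y := fun y hy =>
    Real.toNNReal_pos.2 (div_pos (Real.sqrt_pos.2 hs') (hnorm y hy))
  have hT : ∀ y ∈ S, ∀ z ∈ S, edist (T y) (T z) ≤ ρ y * ρ z * edist y z := by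
    intro y hy z hz
    rw [edist_dist, edist_dist, dist_signedInversion s (hne y hy) (hne z hz)]
    change _ ≤ ENNReal.ofReal _ * ENNReal.ofReal _ * _
    rw [← ENNReal.ofReal_mul (by positivity), ← ENNReal.ofReal_mul (by positivity),
      div_mul_div_comm, Real.mul_self_sqrt hs'.le]
  let f : EuclideanSpace ℝ (Fin (k + 1)) → ℝ := fun y => ‖x - y‖ ^ (-((k : ℝ) - 1))
  let h : EuclideanSpace ℝ (Fin (k + 1)) → ℝ := fun y => |s| * ‖x - y‖ ^ (-((k : ℝ) + 1))
  have hf : Measurable f := by fun_prop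
  have hh : Measurable h := by fun_prop
  have hρpow : ∀ y, (ρ y : ℝ≥0∞) ^ (2 * (k : ℝ)) =
      ENNReal.ofReal (|s| ^ (k : ℝ) * ‖x - y‖ ^ (-(2 * (k : ℝ)))) := by
    intro y
    change ENNReal.ofReal _ ^ _ = _
    rw [ENNReal.ofReal_rpow_of_nonneg (by positivity) (by positivity),
      Real.div_rpow (by positivity) (by positivity), Real.rpow_mul (by positivity),
      Real.rpow_two, Real.sq_sqrt hs'.le, Real.rpow_neg (by positivity), div_eq_mul_inv]
  have hfT : ∀ y ∈ S, (ρ y : ℝ≥0∞) ^ (2 * (k : ℝ)) * ENNReal.ofReal (f (T y)) =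
      ENNReal.ofReal (h y) := by
    intro y hy
    have hy := hnorm y hy
    rw [hρpow, ← ENNReal.ofReal_mul (by positivity)]
    congr 1
    simp only [f, h, T]
    rw [norm_sub_signedInversion, div_eq_mul_inv, Real.mul_rpow (by positivity) (by positivity),
      Real.inv_rpow hy.le, ← Real.rpow_neg hy.le, mul_mul_mul_comm, ← Real.rpow_add hs',
      ← Real.rpow_add hy]
    congr 2
    · rw [← Real.rpow_one |s|, ← Real.rpow_mul hs'.le]
      congr 1
      ring
    · ring
  have hhT : ∀ y ∈ S, (ρ y : ℝ≥0∞) ^ (2 * (k : ℝ)) * ENNReal.ofReal (h (T y)) =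
      ENNReal.ofReal (f y) := by
    intro y hy
    have hy := hnorm y hy
    rw [hρpow, ← ENNReal.ofReal_mul (by positivity)]
    congr 1
    simp only [f, h, T]
    rw [norm_sub_signedInversion, div_eq_mul_inv, Real.mul_rpow (by positivity) (by positivity),
      Real.inv_rpow hy.le, ← Real.rpow_neg hy.le, ← mul_assoc |s|, mul_mul_mul_comm,
      ← Real.rpow_one_add' hs'.le (by linarith [show (1 : ℝ) ≤ k by exact_mod_cast hk]),
      ← Real.rpow_add hs', ← Real.rpow_add hy]
    rw [show (k : ℝ) + (1 + -((k : ℝ) + 1)) = 0 by ring, Real.rpow_zero, one_mul]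
    congr 1
    ring
  rw [integral_eq_lintegral_of_nonneg_ae (.of_forall fun y => by positivity)
      hf.aestronglyMeasurable,
    integral_eq_lintegral_of_nonneg_ae (.of_forall fun y => by positivity)
      hh.aestronglyMeasurable]
  congr 1
  have hchange : ∀ g : EuclideanSpace ℝ (Fin (k + 1)) → ℝ, Measurable g →
      ∫⁻ y in S, ENNReal.ofReal (g y) ∂μH[(k : ℝ)] ≤
        ∫⁻ y in S, (ρ y : ℝ≥0∞) ^ (2 * (k : ℝ)) * ENNReal.ofReal (g (T y)) ∂μH[(k : ℝ)] := by
    intro g hg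
    have := setLIntegral_comp_hausdorffMeasure_le hTm hTT hρ hS hTS hpos hT (Nat.cast_nonneg k)
      (hg.comp hTm).ennreal_ofReal
    simpa only [Function.comp_apply, hTT _] using this
  apply le_antisymm
  · exact (hchange f hf).trans_eq (setLIntegral_congr_fun hS hfT)
  · exact (hchange h hh).trans_eq (setLIntegral_congr_fun hS hhT)
end

section
/- Let a, b be real numbers with a > b > 0 and let p ∈ ℂ. Then ∫_0^{2π} (a − b·sin θ)^{−p} dθ = (a² − b²)^{1/2 − p} · ∫_0^{2π} (a − b·sin θ)^{p−1} dθ, where for a positive real t and complex exponent γ the power t^γ is defined as exp(γ · ln t). -/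
open MeasureTheory Real

/-- The change of variables of the circle exchanging `a - b * sin θ` with
`c ^ 2 / (a - b * sin θ)`, where `c ^ 2 = a ^ 2 - b ^ 2`. -/
noncomputable def anomaly (a b c θ : ℝ) : ℝ :=
  θ - π + 2 * Real.arctan (-(b * Real.cos θ) / (a + c - b * Real.sin θ))

lemma sub_mul_sin_pos {a b : ℝ} (hab : b < a) (hb : 0 < b) (θ : ℝ) :
    0 < a - b * Real.sin θ := by
  nlinarith [Real.sin_le_one θ]

lemma anomaly_add_two_pi (a b c θ : ℝ) :
    anomaly a b c (θ + 2 * π) = anomaly a b c θ + 2 * π := by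
  simp only [anomaly, Real.cos_add_two_pi, Real.sin_add_two_pi]
  ring

lemma sq_add_sq_eq_of_sq_eq {a b c : ℝ} (hc2 : c ^ 2 = a ^ 2 - b ^ 2) (θ : ℝ) :
    (a + c - b * Real.sin θ) ^ 2 + (b * Real.cos θ) ^ 2 =
      2 * (a + c) * (a - b * Real.sin θ) := by
  linear_combination b ^ 2 * Real.sin_sq_add_cos_sq θ + hc2

lemma one_add_div_sq {a b c : ℝ} (hab : b < a) (hb : 0 < b) (hc : 0 < c)
    (hc2 : c ^ 2 = a ^ 2 - b ^ 2) (θ : ℝ) :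
    1 + (-(b * Real.cos θ) / (a + c - b * Real.sin θ)) ^ 2 =
      2 * (a + c) * (a - b * Real.sin θ) / (a + c - b * Real.sin θ) ^ 2 := by
  have hu := sub_mul_sin_pos hab hb θ
  have hD : a + c - b * Real.sin θ ≠ 0 := by linarith
  rw [← sq_add_sq_eq_of_sq_eq hc2 θ]
  field_simp

lemma hasDerivAt_anomaly {a b c : ℝ} (hab : b < a) (hb : 0 < b) (hc : 0 < c)
    (hc2 : c ^ 2 = a ^ 2 - b ^ 2) (θ : ℝ) :
    HasDerivAt (anomaly a b c) (c / (a - b * Real.sin θ)) θ := by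
  have hu := sub_mul_sin_pos hab hb θ
  have hD : a + c - b * Real.sin θ ≠ 0 := by linarith
  have hac : a + c ≠ 0 := by linarith
  have h := ((hasDerivAt_id θ).sub_const π).add
    (((((Real.hasDerivAt_cos θ).const_mul b).neg.div
      (((Real.hasDerivAt_sin θ).const_mul b).const_sub (a + c)) hD).arctan).const_mul 2)
  refine h.congr_deriv ?_
  simp only [Pi.div_apply, Pi.neg_apply]
  rw [one_add_div_sq hab hb hc hc2]
  have hu' := hu.ne'
  field_simp
  linear_combination (-b ^ 2) * Real.sin_sq_add_cos_sq θ - hc2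

lemma sub_mul_sin_anomaly {a b c : ℝ} (hab : b < a) (hb : 0 < b) (hc : 0 < c)
    (hc2 : c ^ 2 = a ^ 2 - b ^ 2) (θ : ℝ) :
    a - b * Real.sin (anomaly a b c θ) = c ^ 2 / (a - b * Real.sin θ) := by
  have hu := sub_mul_sin_pos hab hb θ
  have hu' := hu.ne'
  have hD : a + c - b * Real.sin θ ≠ 0 := by linarith
  have hac : a + c ≠ 0 := by linarith
  set x := -(b * Real.cos θ) / (a + c - b * Real.sin θ) with hx
  have h1 := one_add_div_sq hab hb hc hc2 θ
  rw [← hx] at h1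
  have hcos : Real.cos (Real.arctan x) ^ 2 =
      (a + c - b * Real.sin θ) ^ 2 / (2 * (a + c) * (a - b * Real.sin θ)) := by
    rw [Real.cos_sq_arctan, h1, one_div_div]
  have hsin : Real.sin (Real.arctan x) = x * Real.cos (Real.arctan x) := by
    rw [← Real.tan_mul_cos (Real.cos_arctan_pos x).ne', Real.tan_arctan]
  have hsub : Real.sin (anomaly a b c θ) =
      -(Real.sin θ * (2 * Real.cos (Real.arctan x) ^ 2 - 1) +
        Real.cos θ * (2 * x * Real.cos (Real.arctan x) ^ 2)) := by
    rw [anomaly, ← hx, sub_add_eq_add_sub, Real.sin_sub_pi, Real.sin_add, Real.cos_two_mul,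
      Real.sin_two_mul, hsin]
    ring
  rw [hsub, hcos, hx]
  field_simp
  linear_combination (-b ^ 2 * (a + c - b * Real.sin θ)) * Real.sin_sq_add_cos_sq θ -
    (a + c - b * Real.sin θ) * hc2

theorem stmt_9 (a b : ℝ) (hab : a > b) (hb : b > 0) (p : ℂ) :
    ∫ θ in (0 : ℝ)..(2 * π),
        Complex.exp (-p * (Real.log (a - b * Real.sin θ) : ℂ)) =
    Complex.exp ((1 / 2 - p) * (Real.log (a ^ 2 - b ^ 2) : ℂ)) *
      ∫ θ in (0 : ℝ)..(2 * π),
        Complex.exp ((p - 1) * (Real.log (a - b * Real.sin θ) : ℂ)) := by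
  have hpos : 0 < a ^ 2 - b ^ 2 := by nlinarith
  obtain ⟨c, hc, hc2⟩ : ∃ c : ℝ, 0 < c ∧ c ^ 2 = a ^ 2 - b ^ 2 :=
    ⟨√(a ^ 2 - b ^ 2), Real.sqrt_pos.2 hpos, Real.sq_sqrt hpos.le⟩
  have hu := sub_mul_sin_pos hab hb
  have hu0 : ∀ θ, a - b * Real.sin θ ≠ 0 := fun θ => (hu θ).ne'
  set g : ℝ → ℂ := fun θ => Complex.exp ((p - 1) * (Real.log (a - b * Real.sin θ) : ℂ)) with hg
  have hlog : Continuous fun θ => Real.log (a - b * Real.sin θ) :=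
    (by fun_prop : Continuous fun θ => a - b * Real.sin θ).log hu0
  have hgc : Continuous g := by fun_prop
  have hgp : Function.Periodic g (2 * π) := fun θ => by simp [hg]
  have hsubst := intervalIntegral.integral_deriv_smul_comp (a := 0) (b := 2 * π) (g := g)
    (fun θ _ => hasDerivAt_anomaly hab hb hc hc2 θ)
    (by fun_prop (disch := exact hu0 _) : Continuous fun θ => c / (a - b * Real.sin θ)).continuousOn
    hgc
  have hend : anomaly a b c (2 * π) = anomaly a b c 0 + 2 * π := by
    simpa using anomaly_add_two_pi a b c 0
  rw [hend, hgp.intervalIntegral_add_eq _ 0, zero_add] at hsubst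
  rw [← hsubst, ← intervalIntegral.integral_const_mul]
  refine intervalIntegral.integral_congr fun θ _ => ?_
  have hscale : ((c / (a - b * Real.sin θ) : ℝ) : ℂ) =
      Complex.exp ((Real.log c - Real.log (a - b * Real.sin θ) : ℝ) : ℂ) := by
    rw [← Complex.ofReal_exp, ← Real.log_div hc.ne' (hu0 θ), Real.exp_log (div_pos hc (hu θ))]
  simp only [hg, Function.comp_apply, sub_mul_sin_anomaly hab hb hc hc2, Complex.real_smul]
  rw [hscale, ← Complex.exp_add, ← Complex.exp_add, ← hc2,
    Real.log_div (pow_pos hc 2).ne' (hu0 θ), Real.log_pow]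
  push_cast
  ring_nf
end

section
/- Let k ≥ 1 be an integer, R > 0, and let x ∈ ℝ^{k+1} be a fixed point with |x| ≠ R. Then the function F : ℂ → ℂ defined by F(α) = ∫_{S^k(R)} ω(x,y)^α dS_y is entire (complex differentiable on all of ℂ), with derivative F′(α) = ∫_{S^k(R)} ω(x,y)^α · ln ω(x,y) dS_y. -/
open MeasureTheory

/-- The spherical ratio `ω(x,y) = |‖x‖² − R²| / ‖x − y‖²`. -/
noncomputable def sRatio {n : ℕ} (R : ℝ) (x y : EuclideanSpace ℝ (Fin n)) : ℝ :=
  |‖x‖ ^ 2 - R ^ 2| / ‖x - y‖ ^ 2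

open Metric in
/-- A sphere in Euclidean space of dimension `k + 1` has finite `k`-dimensional Hausdorff measure:
it is covered by finitely many radial projections of faces of a cube. -/
theorem hausdorffMeasure_sphere_lt_top (k : ℕ) {R : ℝ} (hR : 0 < R) :
    μH[(k : ℝ)] (sphere (0 : EuclideanSpace ℝ (Fin (k + 1))) R) < ⊤ := by
  let face (i : Fin (k + 1)) (s : ℝ) (u : Fin k → ℝ) : EuclideanSpace ℝ (Fin (k + 1)) :=
    WithLp.toLp 2 (i.insertNth s u)
  let proj (i : Fin (k + 1)) (s : ℝ) (u : Fin k → ℝ) : EuclideanSpace ℝ (Fin (k + 1)) :=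
    (R / ‖face i s u‖) • face i s u
  let cube : Set (Fin k → ℝ) := closedBall 0 1
  have h_smooth : ∀ (i : Fin (k + 1)) (s : ℝ), s ≠ 0 → ContDiff ℝ 1 (proj i s) := by
    intro i s hs
    have h_face : ContDiff ℝ 1 (face i s) := by
      rw [contDiff_euclidean]
      intro j
      refine i.succAboveCases ?_ (fun j => ?_) j
      · simpa [face] using contDiff_const
      · simpa [face] using contDiff_apply ℝ ℝ j
    have h_ne : ∀ u, face i s u ≠ 0 := by
      intro u h
      have := congrArg (fun v : EuclideanSpace ℝ (Fin (k + 1)) => v i) h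
      simp [face, hs] at this
    exact (contDiff_const.div (h_face.norm ℝ h_ne) fun u => norm_ne_zero_iff.2 (h_ne u)).smul h_face
  have h_finite : ∀ (i : Fin (k + 1)) (s : ℝ), s ≠ 0 →
      μH[(k : ℝ)] (proj i s '' cube) < ⊤ := by
    intro i s hs
    obtain ⟨K, hK⟩ := ((h_smooth i s hs).locallyLipschitz.locallyLipschitzOn
      (s := cube)).exists_lipschitzOnWith_of_compact (isCompact_closedBall 0 1)
    refine (hK.hausdorffMeasure_image_le (Nat.cast_nonneg k)).trans_lt ?_
    have h_vol : (μH[(k : ℝ)] : Measure (Fin k → ℝ)) = volume := by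
      simpa using hausdorffMeasure_pi_real (ι := Fin k)
    rw [h_vol]
    exact ENNReal.mul_lt_top (ENNReal.rpow_lt_top_of_nonneg (Nat.cast_nonneg k) ENNReal.coe_ne_top)
      (isCompact_closedBall 0 1).measure_lt_top
  have h_cover : sphere (0 : EuclideanSpace ℝ (Fin (k + 1))) R ⊆
      ⋃ i : Fin (k + 1), (proj i 1 '' cube ∪ proj i (-1) '' cube) := by
    intro y hy
    have hyR : ‖y‖ = R := by simpa using hy
    obtain ⟨i, hi⟩ := Finite.exists_max fun i => |y i|
    have hM : 0 < |y i| := by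
      by_contra! h
      have : y = 0 := by
        ext j
        exact abs_eq_zero.1 (le_antisymm ((hi j).trans h) (abs_nonneg _))
      simp [this] at hyR
      exact hR.ne hyR
    let u : Fin k → ℝ := fun j => |y i|⁻¹ * y (i.succAbove j)
    have hu : u ∈ cube := by
      rw [mem_closedBall_zero_iff, pi_norm_le_iff_of_nonneg zero_le_one]
      intro j
      rw [Real.norm_eq_abs, abs_mul, abs_inv, abs_abs, inv_mul_le_one₀ hM]
      exact hi _
    have h_proj : ∀ s : ℝ, s = |y i|⁻¹ * y i → proj i s u = y := by
      intro s hs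
      have h_face : face i s u = |y i|⁻¹ • y := by
        ext j
        refine i.succAboveCases ?_ (fun j => ?_) j <;> simp [face, u, hs]
      simp only [proj, h_face, norm_smul, norm_inv, Real.norm_eq_abs, abs_abs, hyR, smul_smul]
      rw [show R / (|y i|⁻¹ * R) * |y i|⁻¹ = 1 by field_simp, one_smul]
    refine Set.mem_iUnion.2 ⟨i, ?_⟩
    rcases abs_pos.1 hM |>.lt_or_gt with h | h
    · exact Or.inr ⟨u, hu, h_proj _ (by rw [abs_of_neg h, inv_neg, neg_mul, inv_mul_cancel₀ h.ne])⟩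
    · exact Or.inl ⟨u, hu, h_proj _ (by rw [abs_of_pos h, inv_mul_cancel₀ h.ne'])⟩
  refine (measure_mono h_cover).trans_lt ?_
  refine (measure_iUnion_le _).trans_lt ?_
  rw [tsum_fintype]
  exact ENNReal.sum_lt_top.2 fun i _ => measure_union_lt_top
    (h_finite i 1 one_ne_zero) (h_finite i (-1) (neg_ne_zero.2 one_ne_zero))

/-- The exponential integral `α ↦ ∫ exp (α ℓ)` over a compact set of finite measure is entire, with
the derivative obtained by differentiating under the integral sign. -/
theorem hasDerivAt_setIntegral_exp_mul {X : Type*} [TopologicalSpace X] [T2Space X]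
    [MeasurableSpace X] [BorelSpace X] {μ : Measure X} {K : Set X} (hK : IsCompact K)
    (hμ : μ K < ⊤) {l : X → ℂ} (hl : ContinuousOn l K) (α : ℂ) :
    HasDerivAt (fun α : ℂ => ∫ y in K, Complex.exp (α * l y) ∂μ)
      (∫ y in K, Complex.exp (α * l y) * l y ∂μ) α := by
  have : IsFiniteMeasure (μ.restrict K) := ⟨by simpa using hμ⟩
  obtain ⟨C, hC⟩ := hK.exists_bound_of_continuousOn hl
  have h_exp : ∀ β : ℂ, ContinuousOn (fun y => Complex.exp (β * l y)) K := fun β =>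
    (continuousOn_const.mul hl).cexp
  have h_meas : ∀ {f : X → ℂ}, ContinuousOn f K → AEStronglyMeasurable f (μ.restrict K) :=
    fun hf => hf.aestronglyMeasurable_of_isCompact hK hK.measurableSet
  have h_norm : ∀ β : ℂ, ∀ y ∈ K, ‖Complex.exp (β * l y)‖ ≤ Real.exp (‖β‖ * C) := by
    intro β y hy
    refine (Complex.norm_exp_le_exp_norm _).trans (Real.exp_le_exp.2 ?_)
    rw [norm_mul]
    exact mul_le_mul_of_nonneg_left (hC y hy) (norm_nonneg _)
  refine (hasDerivAt_integral_of_dominated_loc_of_deriv_le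
    (F' := fun β y => Complex.exp (β * l y) * l y)
    (bound := fun _ => Real.exp ((‖α‖ + 1) * C) * C)
    (Metric.ball_mem_nhds α one_pos)
    (Filter.Eventually.of_forall fun β => h_meas (h_exp β)) ?_
    (h_meas ((h_exp α).mul hl)) ?_ (integrable_const _) ?_).2
  · exact Integrable.of_bound (h_meas (h_exp α)) _
      (ae_restrict_of_forall_mem hK.measurableSet (h_norm α))
  · refine ae_restrict_of_forall_mem hK.measurableSet fun y hy β hβ => ?_
    have hC0 : 0 ≤ C := (norm_nonneg _).trans (hC y hy)
    have hβ' : ‖β‖ ≤ ‖α‖ + 1 := by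
      have h := norm_le_norm_add_norm_sub' β α
      have h' := mem_ball_iff_norm.1 hβ
      linarith
    rw [norm_mul]
    gcongr
    · exact (h_norm β y hy).trans (by gcongr)
    · exact hC y hy
  · refine Filter.Eventually.of_forall fun y β _ => ?_
    simpa using ((hasDerivAt_id β).mul_const (l y)).cexp

/-- Off the sphere, the logarithm of the spherical ratio is continuous on the sphere. -/
theorem continuousOn_log_sRatio {n : ℕ} {R : ℝ} (hR : 0 < R) {x : EuclideanSpace ℝ (Fin n)}
    (hx : ‖x‖ ≠ R) :
    ContinuousOn (fun y => Real.log (sRatio R x y)) (Metric.sphere 0 R) := by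
  have h_num : |‖x‖ ^ 2 - R ^ 2| ≠ 0 := by
    rw [abs_ne_zero, sub_ne_zero]
    exact fun h => hx ((sq_eq_sq₀ (norm_nonneg x) hR.le).1 h)
  have h_den : ∀ y ∈ Metric.sphere (0 : EuclideanSpace ℝ (Fin n)) R, ‖x - y‖ ^ 2 ≠ 0 := by
    intro y hy
    refine pow_ne_zero 2 (norm_ne_zero_iff.2 (sub_ne_zero.2 ?_))
    rintro rfl
    exact hx (by simpa using hy)
  exact (continuousOn_const.div (by fun_prop) h_den).log fun y hy => div_ne_zero h_num (h_den y hy)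

/-- `F(α) = ∫_{S^k(R)} ω(x,y)^α dS_y` is entire, with derivative
`F′(α) = ∫_{S^k(R)} ω^α · ln ω dS_y`. -/
theorem stmt_18 (k : ℕ) (hk : 1 ≤ k) (R : ℝ) (hR : 0 < R)
    (x : EuclideanSpace ℝ (Fin (k + 1))) (hx : ‖x‖ ≠ R) :
    ∀ α : ℂ,
      HasDerivAt
        (fun α : ℂ =>
          ∫ y in Metric.sphere (0 : EuclideanSpace ℝ (Fin (k + 1))) R,
            Complex.exp (α * (Real.log (sRatio R x y) : ℂ)) ∂(μH[(k : ℝ)]))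
        (∫ y in Metric.sphere (0 : EuclideanSpace ℝ (Fin (k + 1))) R,
          Complex.exp (α * (Real.log (sRatio R x y) : ℂ)) *
            (Real.log (sRatio R x y) : ℂ) ∂(μH[(k : ℝ)]))
        α := by
  exact hasDerivAt_setIntegral_exp_mul (isCompact_sphere 0 R) (hausdorffMeasure_sphere_lt_top k hR)
    (Complex.continuous_ofReal.comp_continuousOn (continuousOn_log_sRatio hR hx))
end
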